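/- Every Kakeya set in $\mathbb{R}^2$ has (lower) box-counting dimension equal to $2$. -/

import Mathlib

open MeasureTheory Filter

/-- The lower box (Minkowski) dimension of a bounded set `K ⊆ ℝⁿ`, via the
Minkowski-content characterisation
`n - limsup_{ε → 0⁺} log |K^ε| / log ε`, where `K^ε` is the open
`ε`-neighbourhood of `K`. -/
noncomputable def lowerBoxDim (n : ℕ) (K : Set (EuclideanSpace ℝ (Fin n))) : ℝ :=
  n - limsup (fun ε : ℝ =>
      Real.log (volume (Metric.thickening ε K)).toReal / Real.log ε)
    (nhdsWithin 0 (Set.Ioi 0))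

/-- A Kakeya set in `ℝ²`: a bounded set containing, for every direction `θ` in
some nonempty open subset of the unit circle, a unit line segment with
direction `θ`. -/
def IsKakeya2 (K : Set (EuclideanSpace ℝ (Fin 2))) : Prop :=
  Bornology.IsBounded K ∧
    ∃ Ω : Set (Metric.sphere (0 : EuclideanSpace ℝ (Fin 2)) 1),
      IsOpen Ω ∧ Ω.Nonempty ∧
        ∀ θ ∈ Ω, ∃ a : EuclideanSpace ℝ (Fin 2),
          (fun t : ℝ => a + t • (θ : EuclideanSpace ℝ (Fin 2))) '' Set.Icc 0 1 ⊆ K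

/-- A tube over the interval `[a, b]` around the line `y = β + m x`. -/
def tubeSet (a b β m ε : ℝ) : Set (ℝ × ℝ) :=
  {p | (a ≤ p.1 ∧ p.1 ≤ b) ∧ |p.2 - (β + m * p.1)| < ε}

theorem tubeSet_measurable (a b β m ε : ℝ) : MeasurableSet (tubeSet a b β m ε) := by
  unfold tubeSet
  apply MeasurableSet.inter
  · apply MeasurableSet.inter
    · exact measurableSet_le measurable_const measurable_fst
    · exact measurableSet_le measurable_fst measurable_const
  · exact measurableSet_lt (f := fun p : ℝ × ℝ => |p.2 - (β + m * p.1)|) (by fun_prop) measurable_const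

theorem tubeSet_volume (a b β m ε : ℝ) :
    volume (tubeSet a b β m ε) = ENNReal.ofReal (2 * ε) * ENNReal.ofReal (b - a) := by
  rw [Measure.volume_eq_prod, Measure.prod_apply (tubeSet_measurable _ _ _ _ _)]
  have : ∀ x : ℝ, volume (Prod.mk x ⁻¹' tubeSet a b β m ε)
      = (Set.Icc a b).indicator (fun _ => ENNReal.ofReal (2 * ε)) x := by
    intro x
    by_cases hx : x ∈ Set.Icc a b
    · rw [Set.indicator_of_mem hx]
      have : Prod.mk x ⁻¹' tubeSet a b β m ε = Metric.ball (β + m * x) ε := by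
        ext y
        simp only [tubeSet, Set.mem_preimage, Set.mem_ofPred_eq, Metric.mem_ball, Real.dist_eq]
        exact ⟨fun h => h.2, fun h => ⟨hx, h⟩⟩
      rw [this, Real.volume_ball]
    · rw [Set.indicator_of_notMem hx]
      have : Prod.mk x ⁻¹' tubeSet a b β m ε = ∅ := by
        ext y
        simp only [tubeSet, Set.mem_preimage, Set.mem_ofPred_eq, Set.mem_empty_iff_false, iff_false]
        exact fun h => hx h.1
      rw [this, measure_empty]
  simp_rw [this]
  rw [lintegral_indicator_const measurableSet_Icc, Real.volume_Icc]

theorem tubeSet_real (a b β m ε : ℝ) (hε : 0 ≤ ε) (hab : a ≤ b) :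
    volume.real (tubeSet a b β m ε) = 2 * ε * (b - a) := by
  rw [measureReal_def, tubeSet_volume, ENNReal.toReal_mul, ENNReal.toReal_ofReal (by linarith),
    ENNReal.toReal_ofReal (by linarith)]

theorem tubeSet_ne_top (a b β m ε : ℝ) : volume (tubeSet a b β m ε) ≠ ⊤ := by
  rw [tubeSet_volume]; exact ENNReal.mul_ne_top ENNReal.ofReal_ne_top ENNReal.ofReal_ne_top

theorem tubeSet_inter (a b β m a' b' β' m' ε : ℝ) (hε : 0 < ε) (hm : m' < m) :
    volume.real (tubeSet a b β m ε ∩ tubeSet a' b' β' m' ε) ≤ 8 * ε ^ 2 / (m - m') := by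
  have hd : 0 < m - m' := by linarith
  set c := (β' - β) / (m - m') with hc
  set r := 2 * ε / (m - m') with hr
  have hr0 : 0 < r := by positivity
  have hsub : tubeSet a b β m ε ∩ tubeSet a' b' β' m' ε ⊆ tubeSet (c - r) (c + r) β m ε := by
    rintro ⟨x, y⟩ ⟨⟨_, h1⟩, ⟨_, h2⟩⟩
    simp only at h1 h2
    have h1' := abs_lt.1 h1
    have h2' := abs_lt.1 h2
    refine ⟨?_, h1⟩
    simp only
    have e1 : c * (m - m') = β' - β := by rw [hc]; field_simp
    have e2 : r * (m - m') = 2 * ε := by rw [hr]; field_simp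
    constructor
    · by_contra hlt
      push Not at hlt
      nlinarith
    · by_contra hlt
      push Not at hlt
      nlinarith
  calc _ ≤ volume.real (tubeSet (c - r) (c + r) β m ε) :=
        measureReal_mono hsub (tubeSet_ne_top _ _ _ _ _)
    _ = _ := by
      rw [tubeSet_real _ _ _ _ _ hε.le (by linarith), hr]; field_simp; ring

theorem union_lower {N : ℕ} (T : ℕ → Set (ℝ × ℝ)) (hT : ∀ n, MeasurableSet (T n))
    (hfin : ∀ n, volume (T n) ≠ ⊤) (c : ℝ)
    (h : ∀ n < N, c ≤ volume.real (T n) - ∑ i ∈ Finset.range n, volume.real (T n ∩ T i)) :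
    ∀ n ≤ N, n * c ≤ volume.real (⋃ i ∈ Finset.range n, T i) := by
  intro n
  induction n with
  | zero => intro _; simp
  | succ n ih =>
    intro hn
    have ih' := ih (by omega)
    have hU : volume (⋃ i ∈ Finset.range n, T i) ≠ ⊤ :=
      (measure_biUnion_lt_top (Finset.finite_toSet _) (fun i _ => (hfin i).lt_top)).ne
    have e : (⋃ i ∈ Finset.range (n+1), T i) = (⋃ i ∈ Finset.range n, T i) ∪ T n := by
      rw [Finset.range_add_one, Finset.set_biUnion_insert, Set.union_comm]
    have h1 := measureReal_union_add_inter (μ := volume) (s := ⋃ i ∈ Finset.range n, T i) (hT n) hU (hfin n)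
    have h2 : volume.real ((⋃ i ∈ Finset.range n, T i) ∩ T n)
        ≤ ∑ i ∈ Finset.range n, volume.real (T n ∩ T i) := by
      have : (⋃ i ∈ Finset.range n, T i) ∩ T n = ⋃ i ∈ Finset.range n, (T n ∩ T i) := by
        rw [Set.inter_comm, Set.inter_iUnion₂]
      rw [this]
      exact measureReal_biUnion_finset_le _ _
    have h3 := h n (by omega)
    rw [e]; push_cast; linarith

theorem core_bound (A : Set (ℝ × ℝ)) (hA : volume A ≠ ⊤) (δ ε : ℝ) (hδ1 : δ ≤ 1)
    (hε : 0 < ε) (hε1 : ε ≤ 1) (hs : 16 * ε * (1 + Real.log (1/ε)) ≤ δ / 2)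
    (h : ∀ m : ℝ, 0 ≤ m → m < δ → ∃ a β : ℝ, tubeSet a (a + 1/2) β m ε ⊆ A) :
    δ / (64 * (1 + Real.log (1/ε))) ≤ volume.real A := by
  have hL : 0 ≤ Real.log (1/ε) := Real.log_nonneg (by rw [le_div_iff₀ hε]; linarith)
  set L := Real.log (1/ε) with hLdef
  set s := 16 * ε * (1 + L) with hsdef
  have hs0 : 0 < s := by positivity
  have hδ : 0 < δ := by linarith
  set N := ⌊δ / s⌋₊ with hN
  have hNle : (N : ℝ) ≤ δ / s := Nat.floor_le (by positivity)
  have hNlt : δ / s < N + 1 := Nat.lt_floor_add_one _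
  have hds : 2 ≤ δ / s := by rw [le_div_iff₀ hs0]; linarith
  have hN2 : δ / s / 2 ≤ N := by linarith
  have hNε : (N : ℝ) ≤ 1 / ε := by
    refine hNle.trans ?_
    apply div_le_div₀ zero_le_one hδ1 hε
    rw [hsdef]; nlinarith
  have hex : ∀ n : ℕ, ∃ a β : ℝ, n < N → tubeSet a (a + 1/2) β (n * s) ε ⊆ A := by
    intro n
    by_cases hn : n < N
    · obtain ⟨a, β, hab⟩ := h (n * s) (by positivity) (by
        have : (n : ℝ) < N := by exact_mod_cast hn
        have h2 : (n : ℝ) < δ / s := by linarith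
        rwa [lt_div_iff₀ hs0] at h2)
      exact ⟨a, β, fun _ => hab⟩
    · exact ⟨0, 0, fun h => absurd h hn⟩
  choose a β hab using hex
  have key := union_lower (N := N) (fun n => tubeSet (a n) (a n + 1/2) (β n) (n * s) ε)
    (fun n => tubeSet_measurable _ _ _ _ _) (fun n => tubeSet_ne_top _ _ _ _ _) (ε / 2) (by
      intro n hn
      rw [tubeSet_real _ _ _ _ _ hε.le (by linarith)]
      have hsum : ∑ i ∈ Finset.range n, volume.real (tubeSet (a n) (a n + 1/2) (β n) (n * s) ε ∩
          tubeSet (a i) (a i + 1/2) (β i) (i * s) ε) ≤ 8 * ε ^ 2 / s * (1 + L) := by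
        calc _ ≤ ∑ i ∈ Finset.range n, 8 * ε ^ 2 / s * (((n - 1 - i : ℕ) : ℝ) + 1)⁻¹ := by
              apply Finset.sum_le_sum
              intro i hi
              have hi' : i < n := Finset.mem_range.1 hi
              have hi'' : (i : ℝ) < n := by exact_mod_cast hi'
              refine (tubeSet_inter _ _ _ _ _ _ _ _ _ hε (by nlinarith)).trans ?_
              have : (((n - 1 - i : ℕ) : ℝ) + 1) = n - i := by
                rw [Nat.sub_sub, Nat.cast_sub (by omega)]; push_cast; ring
              rw [this]
              have : (0:ℝ) < n - i := by linarith
              apply le_of_eq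
              rw [← sub_mul]
              field_simp
          _ = 8 * ε ^ 2 / s * ∑ i ∈ Finset.range n, ((i : ℝ) + 1)⁻¹ := by
              rw [← Finset.mul_sum, Finset.sum_range_reflect (fun i => ((i : ℝ) + 1)⁻¹)]
          _ = 8 * ε ^ 2 / s * (harmonic n : ℝ) := by
              simp [harmonic]
          _ ≤ _ := by
              apply mul_le_mul_of_nonneg_left _ (by positivity)
              rcases Nat.eq_zero_or_pos n with h0 | h0
              · subst h0; simp; linarith
              · refine (harmonic_le_one_add_log n).trans ?_
                have : Real.log n ≤ L := by
                  apply Real.log_le_log (by exact_mod_cast h0)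
                  have : (n : ℝ) < N := by exact_mod_cast hn
                  linarith
                linarith
      have : 8 * ε ^ 2 / s * (1 + L) = ε / 2 := by
        rw [hsdef]; field_simp; norm_num
      linarith) N le_rfl
  have hmono : volume.real (⋃ i ∈ Finset.range N, tubeSet (a i) (a i + 1/2) (β i) (i * s) ε)
      ≤ volume.real A :=
    measureReal_mono (Set.iUnion₂_subset fun i hi => hab i (Finset.mem_range.1 hi)) hA
  refine le_trans ?_ (key.trans hmono)
  have : δ / (64 * (1 + L)) = δ / s / 2 * (ε / 2) := by
    rw [hsdef]; field_simp; norm_num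
  rw [this]
  gcongr

theorem frame_exists (u : EuclideanSpace ℝ (Fin 2)) (hu : ‖u‖ = 1) :
    ∃ (v : EuclideanSpace ℝ (Fin 2)) (L : ℝ × ℝ → EuclideanSpace ℝ (Fin 2)),
      ‖v‖ = 1 ∧ inner ℝ u v = 0 ∧ (∀ p, L p = p.1 • u + p.2 • v) ∧ Function.Surjective L ∧
      MeasurePreserving L volume volume := by
  obtain ⟨b, hb⟩ := Orthonormal.exists_orthonormalBasis_extension_of_card_eq (𝕜 := ℝ)
    (E := EuclideanSpace ℝ (Fin 2)) (ι := Fin 2) (by simp) (v := fun _ => u) (s := {0})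
    (by
      constructor
      · intro i; simpa using hu
      · intro i j hij; exact absurd (Subsingleton.elim i j) hij)
  have hb0 : b 0 = u := hb 0 rfl
  have h2 := b.orthonormal.2 (show (0 : Fin 2) ≠ 1 by decide)
  have mp : MeasurePreserving (fun p : ℝ × ℝ => b.repr.symm (!₂[p.1, p.2])) volume volume := by
    have m1 := (volume_preserving_finTwoArrow ℝ).symm
    have m2 := (EuclideanSpace.volume_preserving_symm_measurableEquiv_toLp (Fin 2)).symm
    have m3 := b.repr.symm.measurePreserving
    exact m3.comp (m2.comp m1)
  refine ⟨b 1, fun p => b.repr.symm (!₂[p.1, p.2]), b.orthonormal.1 1, by rw [← hb0]; exact h2, ?_, ?_, mp⟩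
  · intro p
    simp only
    rw [← hb0, ← OrthonormalBasis.sum_repr_symm]
    simp
  · intro w
    refine ⟨(b.repr w 0, b.repr w 1), ?_⟩
    have : (!₂[b.repr w 0, b.repr w 1] : EuclideanSpace ℝ (Fin 2)) = b.repr w := by
      ext i; fin_cases i <;> rfl
    simp [this]

theorem kakeya_lower (K : Set (EuclideanSpace ℝ (Fin 2))) (hK : IsKakeya2 K) :
    ∃ δ : ℝ, 0 < δ ∧ δ ≤ 1 ∧ ∀ ε : ℝ, 0 < ε → ε ≤ 1 →
      16 * ε * (1 + Real.log (1/ε)) ≤ δ / 2 →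
      δ / (64 * (1 + Real.log (1/ε))) ≤ volume.real (Metric.thickening ε K) := by
  obtain ⟨hbd, Ω, hΩ, ⟨θ, hθ⟩, hseg⟩ := hK
  obtain ⟨U, hU, rfl⟩ := isOpen_induced_iff.1 hΩ
  have hu : ‖(θ : EuclideanSpace ℝ (Fin 2))‖ = 1 := by simp
  set u : EuclideanSpace ℝ (Fin 2) := (θ : EuclideanSpace ℝ (Fin 2)) with hudef
  have huU : u ∈ U := hθ
  obtain ⟨v, L, hv, huv, hL, hsurj, hmp⟩ := frame_exists u hu
  have hne : ∀ m : ℝ, u + m • v ≠ 0 := by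
    intro m h
    have : inner ℝ u (u + m • v) = 0 := by rw [h]; simp
    rw [inner_add_right, inner_smul_right, huv, real_inner_self_eq_norm_sq, hu] at this
    norm_num at this
  have hcont : Continuous (fun m : ℝ => ‖u + m • v‖⁻¹ • (u + m • v)) := by
    have c1 : Continuous (fun m : ℝ => ‖u + m • v‖⁻¹) :=
      Continuous.inv₀ (by fun_prop) (fun m => norm_ne_zero_iff.2 (hne m))
    have c2 : Continuous (fun m : ℝ => u + m • v) := by fun_prop
    exact c1.smul c2
  have hopen := hU.preimage hcont
  have h0 : (0 : ℝ) ∈ (fun m : ℝ => ‖u + m • v‖⁻¹ • (u + m • v)) ⁻¹' U := by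
    simp only [Set.mem_preimage, zero_smul, add_zero, hu, inv_one, one_smul]; exact huU
  obtain ⟨δ', hδ', hball⟩ := Metric.isOpen_iff.1 hopen 0 h0
  refine ⟨min δ' 1, by positivity, min_le_right _ _, ?_⟩
  intro ε hε hε1 hs
  have hvol : volume.real (Metric.thickening ε K) = volume.real (L ⁻¹' Metric.thickening ε K) := by
    rw [measureReal_def, measureReal_def,
      hmp.measure_preimage Metric.isOpen_thickening.measurableSet.nullMeasurableSet]
  rw [hvol]
  apply core_bound _ _ _ _ (min_le_right _ _) hε hε1 hs
  · intro m hm0 hm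
    have hm1 : m < 1 := hm.trans_le (min_le_right _ _)
    have hmU := hball (show m ∈ Metric.ball 0 δ' by
      rw [Metric.mem_ball, Real.dist_eq, sub_zero, abs_of_nonneg hm0]
      exact hm.trans_le (min_le_left _ _))
    set n := ‖u + m • v‖ with hn
    have hn0 : 0 < n := norm_pos_iff.2 (hne m)
    have hn2 : n ≤ 2 := by
      calc n ≤ ‖u‖ + ‖m • v‖ := norm_add_le _ _
        _ ≤ 2 := by rw [norm_smul, hu, hv, Real.norm_eq_abs, abs_of_nonneg hm0]; linarith
    obtain ⟨w, hw⟩ := hseg ⟨n⁻¹ • (u + m • v), by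
      simp only [mem_sphere_iff_norm, sub_zero, norm_smul, norm_inv, norm_norm, ← hn]
      rw [Real.norm_of_nonneg hn0.le]
      exact inv_mul_cancel₀ hn0.ne'⟩ hmU
    obtain ⟨⟨x0, y0⟩, rfl⟩ := hsurj w
    refine ⟨x0, y0 - m * x0, ?_⟩
    rintro ⟨x, y⟩ ⟨⟨h1, h2⟩, h3⟩
    simp only at h1 h2 h3
    rw [Set.mem_preimage, Metric.mem_thickening_iff]
    refine ⟨L (x, y0 + m * (x - x0)), hw ⟨n * (x - x0), ⟨by nlinarith, by nlinarith⟩, ?_⟩, ?_⟩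
    · simp only [hL]
      rw [smul_smul, mul_right_comm, mul_inv_cancel₀ hn0.ne', one_mul]
      module
    · rw [dist_eq_norm, hL, hL]
      have : (x, y).1 • u + (x, y).2 • v - ((x, y0 + m * (x - x0)).1 • u
          + (x, y0 + m * (x - x0)).2 • v) = (y - (y0 - m * x0 + m * x)) • v := by
        simp only; module
      rw [this, norm_smul, hv, mul_one]; exact h3
  · rw [hmp.measure_preimage Metric.isOpen_thickening.measurableSet.nullMeasurableSet]
    exact hbd.thickening.measure_lt_top.ne

theorem stmt_5 (K : Set (EuclideanSpace ℝ (Fin 2))) (hK : IsKakeya2 K) :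
    lowerBoxDim 2 K = 2 := by
  obtain ⟨δ, hδ, hδ1, hlow⟩ := kakeya_lower K hK
  have hbd := hK.1
  set C := volume.real (Metric.thickening 1 K) with hC
  have hlog : Tendsto (fun ε : ℝ => Real.log (1/ε)) (nhdsWithin 0 (Set.Ioi 0)) atTop := by
    have := tendsto_neg_atBot_atTop.comp Real.tendsto_log_nhdsGT_zero
    refine this.congr fun ε => ?_
    simp
  have hsmall : ∀ᶠ ε : ℝ in nhdsWithin 0 (Set.Ioi 0), 16 * ε * (1 + Real.log (1/ε)) ≤ δ / 2 := by
    have h1 : Tendsto (fun ε : ℝ => 16 * ε - 16 * (Real.log ε * ε)) (nhdsWithin 0 (Set.Ioi 0))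
        (nhds (16 * 0 - 16 * 0)) := by
      apply Tendsto.sub
      · exact (tendsto_id.mono_left nhdsWithin_le_nhds).const_mul 16
      · have := tendsto_log_mul_rpow_nhdsGT_zero zero_lt_one
        simp only [Real.rpow_one] at this
        exact this.const_mul 16
    have h2 := h1.eventually (gt_mem_nhds (show (16 * 0 - 16 * 0 : ℝ) < δ / 2 by linarith))
    filter_upwards [h2] with ε h
    have : Real.log (1/ε) = - Real.log ε := by simp
    rw [this]; linarith
  have hε1 : ∀ᶠ ε : ℝ in nhdsWithin 0 (Set.Ioi 0), ε < 1 :=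
    (gt_mem_nhds zero_lt_one).filter_mono nhdsWithin_le_nhds
  have hpos : ∀ᶠ ε : ℝ in nhdsWithin 0 (Set.Ioi 0), 0 < ε := self_mem_nhdsWithin
  have hlim : Tendsto (fun ε : ℝ => Real.log (volume (Metric.thickening ε K)).toReal / Real.log ε)
      (nhdsWithin 0 (Set.Ioi 0)) (nhds 0) := by
    have hF : Tendsto (fun x : ℝ => Real.log (1 + x) / x) atTop (nhds 0) := by
      have h1 : Tendsto (fun x : ℝ => Real.log (1 + x) / (1 * (1 + x) + (-1))) atTop (nhds 0) := by
        have := (Real.tendsto_pow_log_div_mul_add_atTop 1 (-1) 1 one_ne_zero).comp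
          (tendsto_atTop_add_const_left atTop (1:ℝ) tendsto_id)
        simpa [Function.comp_def] using this
      refine h1.congr fun x => ?_
      congr 1; ring
    have hlo : Tendsto (fun ε : ℝ => - (Real.log C / Real.log (1/ε))) (nhdsWithin 0 (Set.Ioi 0))
        (nhds 0) := by
      simpa using (hlog.const_div_atTop (Real.log C)).neg
    have hhi : Tendsto (fun ε : ℝ => Real.log (1 + Real.log (1/ε)) / Real.log (1/ε)
        - Real.log (δ / 64) / Real.log (1/ε)) (nhdsWithin 0 (Set.Ioi 0)) (nhds 0) := by
      simpa using (hF.comp hlog).sub (hlog.const_div_atTop (Real.log (δ / 64)))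
    refine tendsto_of_tendsto_of_tendsto_of_le_of_le' hlo hhi ?_ ?_
    · filter_upwards [hsmall, hε1, hpos] with ε hs h1 h0
      have hl : 0 < Real.log (1/ε) := Real.log_pos (by rw [lt_div_iff₀ h0]; linarith)
      have hl2 : Real.log ε = - Real.log (1/ε) := by simp
      have hV := hlow ε h0 h1.le hs
      have hV0 : 0 < volume.real (Metric.thickening ε K) := lt_of_lt_of_le (by positivity) hV
      rw [hl2, div_neg, neg_le_neg_iff]
      have : Real.log (volume.real (Metric.thickening ε K)) ≤ Real.log C :=
        Real.log_le_log hV0 (measureReal_mono (Metric.thickening_mono h1.le K)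
          hbd.thickening.measure_lt_top.ne)
      exact div_le_div_of_nonneg_right this hl.le
    · filter_upwards [hsmall, hε1, hpos] with ε hs h1 h0
      have hl : 0 < Real.log (1/ε) := Real.log_pos (by rw [lt_div_iff₀ h0]; linarith)
      have hl2 : Real.log ε = - Real.log (1/ε) := by simp
      have hV := hlow ε h0 h1.le hs
      have h3 := Real.log_le_log (by positivity) hV
      rw [← div_div, Real.log_div (by positivity) (by positivity)] at h3
      rw [hl2, div_neg, ← sub_div, ← neg_div]
      apply div_le_div_of_nonneg_right _ hl.le
      rw [measureReal_def] at h3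
      linarith
  unfold lowerBoxDim
  rw [hlim.limsup_eq]
  norm_num
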